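/- The Reverse algorithm is almost everywhere exponentially convergent: for μ-almost every x = (x₀,x₁,x₂) ∈ Δ̄ there exist α > 1 and N ∈ ℕ such that for all n ≥ N and every i ∈ {0,1,2}, writing A^{(n)}(x) = (p^{(n)}_{ij})_{0≤i,j≤2} and p^{(n)}_i = p^{(n)}_{i0} + p^{(n)}_{i1} + p^{(n)}_{i2}, one has max(|p^{(n)}_{i1} − p^{(n)}_i·x₁|, |p^{(n)}_{i2} − p^{(n)}_i·x₂|) < (p^{(n)}_i)^{1−α}. -/

import Mathlib

open MeasureTheory Matrix

noncomputable section

/-- The four matrices of the Reverse algorithm. -/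
def M1 : Matrix (Fin 3) (Fin 3) ℝ := !![1,1,1; 0,1,0; 0,0,1]
def M2 : Matrix (Fin 3) (Fin 3) ℝ := !![1,0,0; 1,1,1; 0,0,1]
def M3 : Matrix (Fin 3) (Fin 3) ℝ := !![1,0,0; 0,1,0; 1,1,1]
def M4 : Matrix (Fin 3) (Fin 3) ℝ := !![0,1,1; 1,0,1; 1,1,0]

def Mat : Fin 4 → Matrix (Fin 3) (Fin 3) ℝ := ![M1, M2, M3, M4]

/-- The closed standard 2-simplex in ℝ³. -/
def simplexBar : Set (Fin 3 → ℝ) := {x | (∀ i, 0 ≤ x i) ∧ x 0 + x 1 + x 2 = 1}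

/-- The open standard 2-simplex in ℝ³. -/
def simplexOpen : Set (Fin 3 → ℝ) := {x | (∀ i, 0 < x i) ∧ x 0 + x 1 + x 2 = 1}

/-- The projectivized Reverse algorithm map. -/
def fR (x : Fin 3 → ℝ) : Fin 3 → ℝ :=
  if 1 < 2 * x 0 then ![(x 0 - x 1 - x 2) / x 0, x 1 / x 0, x 2 / x 0]
  else if 1 < 2 * x 1 then ![x 0 / x 1, (-x 0 + x 1 - x 2) / x 1, x 2 / x 1]
  else if 1 < 2 * x 2 then ![x 0 / x 2, x 1 / x 2, (-x 0 - x 1 + x 2) / x 2]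
  else ![-x 0 + x 1 + x 2, x 0 - x 1 + x 2, x 0 + x 1 - x 2]

/-- The digit `a(x)` of a point: the index of the cell `Δ(a(x))` containing `x`. -/
def digit (x : Fin 3 → ℝ) : Fin 4 :=
  if 1 < 2 * x 0 then 0 else if 1 < 2 * x 1 then 1 else if 1 < 2 * x 2 then 2 else 3

/-- The cocycle `A^{(n)}(x) = ᵗM_{a(f^{n-1}x)} ⋯ ᵗM_{a(fx)} ᵗM_{a(x)}`. -/
def Acoc : ℕ → (Fin 3 → ℝ) → Matrix (Fin 3) (Fin 3) ℝ
  | 0, _ => 1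
  | n+1, x => Acoc n (fR x) * (Mat (digit x))ᵀ

/-- The invariant measure μ of the Reverse algorithm: in coordinates (x₁,x₂) it has
density 4/(π²(x₁+x₂)(1-x₁)(1-x₂)) on the open triangle. -/
def muR : Measure (Fin 3 → ℝ) :=
  Measure.map (fun p : ℝ × ℝ => ![1 - p.1 - p.2, p.1, p.2])
    (((volume : Measure (ℝ × ℝ)).restrict
        {p : ℝ × ℝ | 0 < p.1 ∧ 0 < p.2 ∧ p.1 + p.2 < 1}).withDensity
      (fun p => ENNReal.ofReal (4 / (Real.pi ^ 2 * (p.1 + p.2) * (1 - p.1) * (1 - p.2)))))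

open Filter Set in
/-- Garsia's form of the maximal ergodic theorem: if every point of a finite measure preserving
system has a positive Birkhoff sum of `g`, then `g` has nonnegative integral. -/
theorem integral_nonneg_of_exists_birkhoffSum_pos {X : Type*} [MeasurableSpace X]
    {μ : Measure X} [IsFiniteMeasure μ] {T : X → X} (hT : MeasurePreserving T μ μ)
    {g : X → ℝ} (hg : Measurable g) (hgi : Integrable g μ)
    (h : ∀ᵐ x ∂μ, ∃ n, 0 < birkhoffSum T g n x) : 0 ≤ ∫ x, g x ∂μ := by
  let ψ : ℕ → X → ℝ := fun n => Nat.rec (fun _ => 0) (fun _ f x => max 0 (g x + f (T x))) n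
  have ψ_succ : ∀ n x, ψ (n + 1) x = max 0 (g x + ψ n (T x)) := fun _ _ => rfl
  have ψ_nonneg : ∀ n x, 0 ≤ ψ n x := by
    intro n x
    cases n with
    | zero => exact le_rfl
    | succ n => exact le_max_left _ _
  have ψ_mono : ∀ n x, ψ n x ≤ ψ (n + 1) x := by
    intro n
    induction n with
    | zero => exact fun x => ψ_nonneg 1 x
    | succ n ih =>
      intro x
      rw [ψ_succ n, ψ_succ (n + 1)]
      exact max_le_max le_rfl (by linarith [ih (T x)])
  have ψ_meas : ∀ n, Measurable (ψ n) := by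
    intro n
    induction n with
    | zero => exact measurable_const
    | succ n ih => exact measurable_const.max (hg.add (ih.comp hT.measurable))
  have ψ_int : ∀ n, Integrable (ψ n) μ := by
    intro n
    induction n with
    | zero => exact integrable_zero _ _ _
    | succ n ih =>
      exact (integrable_zero _ _ _).sup (hgi.add (hT.integrable_comp_of_integrable ih))
  have ψ_ge : ∀ n x, birkhoffSum T g n x ≤ ψ n x := by
    intro n
    induction n with
    | zero => exact fun x => by simpa using ψ_nonneg 0 x
    | succ n ih =>
      intro x
      rw [birkhoffSum_succ', ψ_succ]
      exact le_max_of_le_right (by linarith [ih (T x)])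
  let P : ℕ → Set X := fun n => {x | 0 < g x + ψ n (T x)}
  have P_meas : ∀ n, MeasurableSet (P n) := fun n =>
    measurableSet_lt measurable_const (hg.add ((ψ_meas n).comp hT.measurable))
  have P_mono : Monotone P := monotone_nat_of_le_succ fun n x hx =>
    lt_of_lt_of_le (show 0 < g x + ψ n (T x) from hx) (by linarith [ψ_mono n (T x)])
  have P_int : ∀ n, 0 ≤ ∫ x in P n, g x ∂μ := by
    intro n
    have hc : Integrable (fun x => ψ n (T x)) μ := hT.integrable_comp_of_integrable (ψ_int n)
    have e1 : ∫ x, ψ (n + 1) x ∂μ = ∫ x in P n, (g x + ψ n (T x)) ∂μ := by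
      rw [← integral_indicator (P_meas n)]
      refine integral_congr_ae (Eventually.of_forall fun x => ?_)
      by_cases hx : x ∈ P n
      · rw [indicator_of_mem hx]
        exact max_eq_right (le_of_lt hx)
      · rw [indicator_of_notMem hx]
        exact max_eq_left (not_lt.1 hx)
    have e2 : ∫ x in P n, (g x + ψ n (T x)) ∂μ
        = ∫ x in P n, g x ∂μ + ∫ x in P n, ψ n (T x) ∂μ :=
      integral_add hgi.integrableOn hc.integrableOn
    have e3 : ∫ x in P n, ψ n (T x) ∂μ ≤ ∫ x, ψ n (T x) ∂μ :=
      setIntegral_le_integral hc (Eventually.of_forall fun x => ψ_nonneg n (T x))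
    have e4 : ∫ x, ψ n (T x) ∂μ = ∫ x, ψ n x ∂μ := by
      have := integral_map (μ := μ) hT.measurable.aemeasurable (f := ψ n)
        (ψ_meas n).aestronglyMeasurable
      rw [hT.map_eq] at this
      exact this.symm
    have e5 : ∫ x, ψ n x ∂μ ≤ ∫ x, ψ (n + 1) x ∂μ :=
      integral_mono (ψ_int n) (ψ_int (n + 1)) (ψ_mono n)
    linarith
  have hU : ∀ᵐ x ∂μ, x ∈ ⋃ n, P n := by
    filter_upwards [h] with x hx
    obtain ⟨n, hn⟩ := hx
    cases n with
    | zero => simp at hn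
    | succ n =>
      refine mem_iUnion.2 ⟨n, ?_⟩
      have := hn.trans_le (ψ_ge (n + 1) x)
      rw [ψ_succ] at this
      rcases lt_max_iff.1 this with h0 | h0
      · exact absurd h0 (lt_irrefl _)
      · exact h0
  have hlim := tendsto_setIntegral_of_monotone (μ := μ) P_meas P_mono hgi.integrableOn
  rw [setIntegral_eq_integral_of_ae_compl_eq_zero
    (by filter_upwards [hU] with x hx hx' using absurd hx hx')] at hlim
  exact ge_of_tendsto' hlim P_int

/-- In a finite measure preserving system, almost every point that visits a measurable set `B`
visits it with positive lower frequency. -/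
theorem ae_positive_frequency_of_visit {X : Type*} [MeasurableSpace X]
    {μ : Measure X} [IsFiniteMeasure μ] {T : X → X} (hT : MeasurePreserving T μ μ)
    {B : Set X} (hB : MeasurableSet B) :
    ∀ᵐ x ∂μ, (∃ s, T^[s] x ∈ B) →
      ∃ k : ℕ, ∀ᶠ n : ℕ in Filter.atTop,
        (n : ℝ) ≤ birkhoffSum T (B.indicator fun _ => (1 : ℝ)) n x * (k + 1) := by
  set f : X → ℝ := B.indicator fun _ => (1 : ℝ) with hf
  have f_meas : Measurable f := measurable_const.indicator hB
  have f_nonneg : ∀ x, 0 ≤ f x := fun x => Set.indicator_nonneg (fun _ _ => zero_le_one) x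
  have f_le : ∀ x, f x ≤ 1 := fun x => Set.indicator_le_self' (fun _ _ => zero_le_one) x
  have S_meas : ∀ n, Measurable (birkhoffSum T f n) := fun n =>
    Finset.measurable_fun_sum _ fun k _ => f_meas.comp (hT.measurable.iterate k)
  let L : Set X := {x | ∀ k : ℕ, ∀ a : ℕ, ∃ n : ℕ, a ≤ n ∧ birkhoffSum T f n x * (k + 1) < n}
  have L_meas : MeasurableSet L := by
    have : L = ⋂ k : ℕ, ⋂ a : ℕ, ⋃ n : ℕ, ⋃ _ : a ≤ n,
        {x | birkhoffSum T f n x * (k + 1) < n} := by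
      ext x; simp [L]
    rw [this]
    exact MeasurableSet.iInter fun k => MeasurableSet.iInter fun a => MeasurableSet.iUnion fun n =>
      MeasurableSet.iUnion fun _ => measurableSet_lt ((S_meas n).mul_const _) measurable_const
  have L_inv : T ⁻¹' L = L := by
    ext x
    constructor
    · intro hx k a
      obtain ⟨n, hn, h⟩ := hx (2 * k + 1) (a + 2 * (k + 1))
      refine ⟨n + 1, by omega, ?_⟩
      rw [birkhoffSum_succ']
      have h1 : ((a + 2 * (k + 1) : ℕ) : ℝ) ≤ n := by exact_mod_cast hn
      push_cast at h h1 ⊢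
      have h2 : f x * ((k : ℝ) + 1) ≤ 1 * ((k : ℝ) + 1) :=
        mul_le_mul_of_nonneg_right (f_le x) (by positivity)
      have h3 : (0 : ℝ) ≤ a := by positivity
      nlinarith
    · intro hx k a
      obtain ⟨n, hn, h⟩ := hx (2 * k + 1) (a + 2)
      obtain ⟨m, rfl⟩ : ∃ m, n = m + 1 := ⟨n - 1, by omega⟩
      refine ⟨m, by omega, ?_⟩
      rw [birkhoffSum_succ'] at h
      have h1 : ((a + 2 : ℕ) : ℝ) ≤ ((m + 1 : ℕ) : ℝ) := by exact_mod_cast hn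
      push_cast at h h1 ⊢
      have h2 : 0 ≤ f x * ((k : ℝ) + 1) := mul_nonneg (f_nonneg x) (by positivity)
      have h3 : (0 : ℝ) ≤ a := by positivity
      nlinarith
  have hTL : MeasurePreserving T (μ.restrict L) (μ.restrict L) := by
    have := hT.restrict_preimage L_meas
    rwa [L_inv] at this
  have f_int : ∀ ν : Measure X, IsFiniteMeasure ν → Integrable f ν := fun ν _ =>
    (integrable_const (1 : ℝ)).indicator hB
  have key : ∀ k : ℕ, (∫ x in L, f x ∂μ) * (k + 1) ≤ μ.real L := by
    intro k
    have h0 := integral_nonneg_of_exists_birkhoffSum_pos hTL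
      (g := fun x => 1 - f x * (k + 1)) (measurable_const.sub (f_meas.mul_const _))
      ((integrable_const _).sub ((f_int _ inferInstance).mul_const _)) ?_
    · rw [integral_sub (integrable_const _) ((f_int _ inferInstance).mul_const _),
        integral_mul_const] at h0
      simp only [integral_const, smul_eq_mul, mul_one, measureReal_restrict_apply_univ] at h0
      linarith
    · filter_upwards [ae_restrict_mem L_meas] with x hx
      obtain ⟨n, -, h⟩ := hx k 0
      refine ⟨n, ?_⟩
      simp only [birkhoffSum, Finset.sum_sub_distrib, ← Finset.sum_mul] at h ⊢
      simp only [Finset.sum_const, Finset.card_range, nsmul_eq_mul, mul_one]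
      linarith
  have hzero : ∫ x in L, f x ∂μ = 0 := by
    refine le_antisymm ?_ (integral_nonneg f_nonneg)
    by_contra! hpos
    obtain ⟨k, hk⟩ := exists_nat_gt (μ.real L / (∫ x in L, f x ∂μ))
    rw [div_lt_iff₀ hpos] at hk
    nlinarith [key k]
  have hnull : μ (B ∩ L) = 0 := by
    rw [integral_indicator hB, integral_const, smul_eq_mul, mul_one,
      measureReal_restrict_apply_univ, measureReal_restrict_apply hB] at hzero
    exact (measureReal_eq_zero_iff).1 hzero
  have hae : ∀ᵐ x ∂μ, ∀ s, T^[s] x ∉ B ∩ L :=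
    ae_all_iff.2 fun s =>
      (hT.iterate s).quasiMeasurePreserving.ae (measure_eq_zero_iff_ae_notMem.1 hnull)
  filter_upwards [hae] with x hx ⟨s, hs⟩
  have hxL : x ∉ L := by
    intro hxL
    refine hx s ⟨hs, ?_⟩
    clear hs
    induction s with
    | zero => exact hxL
    | succ s ih =>
      rw [Function.iterate_succ_apply']
      have : T^[s] x ∈ T ⁻¹' L := by rwa [L_inv]
      exact this
  simp only [L, Set.mem_ofPred_eq, not_forall, not_exists, not_and, not_lt] at hxL
  obtain ⟨k, a, h⟩ := hxL
  exact ⟨k, Filter.eventually_atTop.2 ⟨a, h⟩⟩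

/-- The oscillation (largest difference of two entries) of a vector in `ℝ³`. -/
def osc (w : Fin 3 → ℝ) : ℝ := max (max |w 0 - w 1| |w 0 - w 2|) |w 1 - w 2|

theorem osc_le_iff {w : Fin 3 → ℝ} {r : ℝ} : osc w ≤ r ↔ ∀ i j, |w i - w j| ≤ r := by
  constructor
  · intro h
    simp only [osc, max_le_iff] at h
    obtain ⟨⟨h01, h02⟩, h12⟩ := h
    have hr : 0 ≤ r := (abs_nonneg _).trans h01
    intro i j
    fin_cases i <;> fin_cases j <;>
      simp only [Fin.zero_eta, Fin.mk_one, Fin.reduceFinMk, sub_self, abs_zero] <;>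
      first | assumption | (rw [abs_sub_comm]; assumption)
  · exact fun h => max_le (max_le (h 0 1) (h 0 2)) (h 1 2)

theorem abs_sub_le_osc (w : Fin 3 → ℝ) (i j : Fin 3) : |w i - w j| ≤ osc w :=
  osc_le_iff.1 le_rfl i j

theorem osc_nonneg (w : Fin 3 → ℝ) : 0 ≤ osc w :=
  (abs_nonneg _).trans (abs_sub_le_osc w 0 0)

/-- A vector orthogonal to `y` in the simplex has entries bounded by its oscillation, with a
definite gain when the corresponding entry of `y` is bounded below. -/
theorem abs_le_of_orthogonal {y w : Fin 3 → ℝ} {δ : ℝ} (hy : ∀ i, 0 ≤ y i)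
    (hs : y 0 + y 1 + y 2 = 1) (h : y 0 * w 0 + y 1 * w 1 + y 2 * w 2 = 0)
    (i : Fin 3) (hδ : δ ≤ y i) : |w i| ≤ (1 - δ) * osc w := by
  have e : w i = y 0 * (w i - w 0) + y 1 * (w i - w 1) + y 2 * (w i - w 2) := by
    linear_combination (-w i) * hs + h
  have b : ∀ j, |y j * (w i - w j)| ≤ y j * (if j = i then 0 else osc w) := by
    intro j
    rw [abs_mul, abs_of_nonneg (hy j)]
    refine mul_le_mul_of_nonneg_left ?_ (hy j)
    split_ifs with hji
    · simp [hji]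
    · exact abs_sub_le_osc w i j
  have h1 : |w i| ≤ y 0 * (if 0 = i then 0 else osc w) + y 1 * (if 1 = i then 0 else osc w)
      + y 2 * (if 2 = i then 0 else osc w) := by
    rw [e]
    exact (abs_add_three _ _ _).trans (add_le_add (add_le_add (b 0) (b 1)) (b 2))
  have h2 : y i * osc w ≥ δ * osc w := mul_le_mul_of_nonneg_right hδ (osc_nonneg w)
  have h3 : (y 0 + y 1 + y 2) * osc w = osc w := by rw [hs, one_mul]
  refine h1.trans ?_
  fin_cases i <;> simp at h2 ⊢ <;> linarith

/-- The effect of a transposed digit matrix on a vector. -/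
theorem transpose_Mat_mulVec (d : Fin 4) (w : Fin 3 → ℝ) :
    (Mat d)ᵀ *ᵥ w = ![![w 0, w 0 + w 1, w 0 + w 2], ![w 0 + w 1, w 1, w 1 + w 2],
      ![w 0 + w 2, w 1 + w 2, w 2], ![w 1 + w 2, w 0 + w 2, w 0 + w 1]] d := by
  ext i
  fin_cases d <;> fin_cases i <;>
    simp [Mat, M1, M2, M3, M4, mulVec, dotProduct, Fin.sum_univ_three]

theorem transpose_Mat_mulVec_sub_of_eq {i : Fin 3} (w : Fin 3 → ℝ) (j : Fin 3) (hj : j ≠ i) :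
    ((Mat i.castSucc)ᵀ *ᵥ w) j - ((Mat i.castSucc)ᵀ *ᵥ w) i = w j := by
  rw [transpose_Mat_mulVec]
  fin_cases i <;> fin_cases j <;> simp_all

theorem transpose_Mat_mulVec_sub_of_ne {i : Fin 3} (w : Fin 3 → ℝ) (j k : Fin 3) (hj : j ≠ i)
    (hk : k ≠ i) :
    ((Mat i.castSucc)ᵀ *ᵥ w) j - ((Mat i.castSucc)ᵀ *ᵥ w) k = w j - w k := by
  rw [transpose_Mat_mulVec]
  fin_cases i <;> fin_cases j <;> fin_cases k <;> simp_all <;> ring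

theorem transpose_Mat_three_mulVec_sub (w : Fin 3 → ℝ) (j k : Fin 3) :
    ((Mat 3)ᵀ *ᵥ w) j - ((Mat 3)ᵀ *ᵥ w) k = -(w j - w k) := by
  rw [transpose_Mat_mulVec]
  fin_cases j <;> fin_cases k <;> simp <;> ring

/-- A bound for the oscillation after applying the digit `i ∈ {0, 1, 2}`. -/
theorem osc_transpose_Mat_le {i : Fin 3} {w : Fin 3 → ℝ} {r : ℝ}
    (h1 : ∀ j, j ≠ i → |w j| ≤ r) (h2 : ∀ j k, j ≠ i → k ≠ i → |w j - w k| ≤ r) :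
    osc ((Mat i.castSucc)ᵀ *ᵥ w) ≤ r := by
  have hr : 0 ≤ r := by
    obtain ⟨j, hj⟩ := exists_ne i
    exact (abs_nonneg _).trans (h1 j hj)
  refine osc_le_iff.2 fun j k => ?_
  by_cases hj : j = i
  · by_cases hk : k = i
    · simpa [hj, hk] using hr
    · rw [abs_sub_comm, hj, transpose_Mat_mulVec_sub_of_eq w k hk]
      exact h1 k hk
  · by_cases hk : k = i
    · rw [hk, transpose_Mat_mulVec_sub_of_eq w j hj]
      exact h1 j hj
    · rw [transpose_Mat_mulVec_sub_of_ne w j k hj hk]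
      exact h2 j k hj hk

theorem eq_three_or_castSucc (d : Fin 4) : d = 3 ∨ ∃ i : Fin 3, d = i.castSucc := by
  fin_cases d
  exacts [Or.inr ⟨0, rfl⟩, Or.inr ⟨1, rfl⟩, Or.inr ⟨2, rfl⟩, Or.inl rfl]

/-- The oscillation does not increase along the cocycle. -/
theorem osc_transpose_Mat_le_osc {y w : Fin 3 → ℝ} (hy : y ∈ simplexOpen)
    (h : y 0 * w 0 + y 1 * w 1 + y 2 * w 2 = 0) (d : Fin 4) :
    osc ((Mat d)ᵀ *ᵥ w) ≤ osc w := by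
  rcases eq_three_or_castSucc d with rfl | ⟨i, rfl⟩
  · refine osc_le_iff.2 fun j k => ?_
    rw [transpose_Mat_three_mulVec_sub, abs_neg]
    exact abs_sub_le_osc w j k
  · refine osc_transpose_Mat_le (fun j _ => ?_) fun j k _ _ => abs_sub_le_osc w j k
    simpa using abs_le_of_orthogonal (fun i => (hy.1 i).le) hy.2 h j (hy.1 j).le

/-- Orthogonality is preserved by the algorithm. -/
theorem orthogonal_fR {y w : Fin 3 → ℝ} (h : y 0 * w 0 + y 1 * w 1 + y 2 * w 2 = 0) :
    fR y 0 * ((Mat (digit y))ᵀ *ᵥ w) 0 + fR y 1 * ((Mat (digit y))ᵀ *ᵥ w) 1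
      + fR y 2 * ((Mat (digit y))ᵀ *ᵥ w) 2 = 0 := by
  rw [transpose_Mat_mulVec]
  unfold fR digit
  split_ifs with h0 h1 h2
  · have : y 0 ≠ 0 := by intro h; norm_num [h] at h0
    simp; field_simp; linear_combination h
  · have : y 1 ≠ 0 := by intro h; norm_num [h] at h1
    simp; field_simp; linear_combination h
  · have : y 2 ≠ 0 := by intro h; norm_num [h] at h2
    simp; field_simp; linear_combination h
  · simp; linear_combination 2 * h

theorem Acoc_succ' (n : ℕ) (x : Fin 3 → ℝ) :
    Acoc (n + 1) x = (Mat (digit (fR^[n] x)))ᵀ * Acoc n x := by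
  induction n generalizing x with
  | zero => simp [Acoc]
  | succ n ih =>
    rw [Acoc, ih (fR x), Matrix.mul_assoc, ← Acoc, Function.iterate_succ_apply]

theorem Acoc_succ_mulVec (n : ℕ) (x w : Fin 3 → ℝ) :
    Acoc (n + 1) x *ᵥ w = (Mat (digit (fR^[n] x)))ᵀ *ᵥ (Acoc n x *ᵥ w) := by
  rw [Acoc_succ', mulVec_mulVec]

theorem orthogonal_Acoc {x w : Fin 3 → ℝ} (h : x 0 * w 0 + x 1 * w 1 + x 2 * w 2 = 0) (n : ℕ) :
    (fR^[n] x) 0 * (Acoc n x *ᵥ w) 0 + (fR^[n] x) 1 * (Acoc n x *ᵥ w) 1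
      + (fR^[n] x) 2 * (Acoc n x *ᵥ w) 2 = 0 := by
  induction n with
  | zero => simpa [Acoc] using h
  | succ n ih =>
    rw [Acoc_succ_mulVec, Function.iterate_succ_apply']
    exact orthogonal_fR ih

/-- The set of points whose digit expansion starts with `i, 3, …, 3, j` for distinct
`i, j ∈ {0, 1, 2}`, with `K` the position of `j`, and such that the entries of the point and of
its `K`-th iterate are at least `δ`. -/
def contractionSet (K : ℕ) (δ : ℝ) : Set (Fin 3 → ℝ) :=
  {x | digit x ≠ 3 ∧ digit (fR^[K] x) ≠ 3 ∧ digit (fR^[K] x) ≠ digit x ∧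
    (∀ l, 0 < l → l < K → digit (fR^[l] x) = 3) ∧ (∀ i, δ ≤ x i) ∧ ∀ i, δ ≤ (fR^[K] x) i}

/-- The oscillation is contracted by `1 - δ` on `contractionSet K δ`. -/
theorem osc_le_of_mem_contractionSet {K : ℕ} {δ : ℝ} {x w : Fin 3 → ℝ}
    (hx : ∀ n, fR^[n] x ∈ simplexOpen) (h : x 0 * w 0 + x 1 * w 1 + x 2 * w 2 = 0)
    (hδ : δ < 1) (hB : x ∈ contractionSet K δ) :
    osc (Acoc (K + 1) x *ᵥ w) ≤ (1 - δ) * osc w := by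
  obtain ⟨hd, hK, hne, hmid, hx1, hx2⟩ := hB
  obtain ⟨d, hd'⟩ := (eq_three_or_castSucc (digit x)).resolve_left hd
  obtain ⟨e, he'⟩ := (eq_three_or_castSucc (digit (fR^[K] x))).resolve_left hK
  have hed : d ≠ e := by
    rintro rfl
    exact hne (he'.trans hd'.symm)
  have hK0 : 0 < K := by
    rcases Nat.eq_zero_or_pos K with rfl | h0
    · exact absurd rfl hne
    · exact h0
  have hosc : ∀ n, osc (Acoc n x *ᵥ w) ≤ osc w := by
    intro n
    induction n with
    | zero => simp [Acoc]
    | succ n ih =>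
      rw [Acoc_succ_mulVec]
      exact (osc_transpose_Mat_le_osc (hx n) (orthogonal_Acoc h n) _).trans ih
  have hdiff : ∀ n, 0 < n → n ≤ K → ∀ j, j ≠ d →
      |(Acoc n x *ᵥ w) j - (Acoc n x *ᵥ w) d| ≤ (1 - δ) * osc w := by
    intro n hn
    induction n, hn using Nat.le_induction with
    | base =>
      intro _ j hj
      rw [Acoc_succ_mulVec, Function.iterate_zero_apply, hd', transpose_Mat_mulVec_sub_of_eq _ j hj]
      simpa [Acoc] using abs_le_of_orthogonal (fun i => ((hx 0).1 i).le) (hx 0).2 h j (hx1 j)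
    | succ n hn ih =>
      intro hnK j hj
      rw [Acoc_succ_mulVec, hmid n hn (by omega), transpose_Mat_three_mulVec_sub, abs_neg]
      exact ih (by omega) j hj
  rw [Acoc_succ_mulVec, he']
  have hdist := hdiff K hK0 le_rfl
  have h0 : 0 ≤ (1 - δ) * osc w := mul_nonneg (by linarith) (osc_nonneg w)
  refine osc_transpose_Mat_le (fun j _ => ?_) fun j k hj hk => ?_
  · exact (abs_le_of_orthogonal (fun i => ((hx K).1 i).le) (hx K).2 (orthogonal_Acoc h K) j
      (hx2 j)).trans (mul_le_mul_of_nonneg_left (hosc K) (by linarith))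
  · by_cases hjd : j = d
    · by_cases hkd : k = d
      · simpa [hjd, hkd] using h0
      · rw [abs_sub_comm, hjd]
        exact hdist k hkd
    · by_cases hkd : k = d
      · rw [hkd]
        exact hdist j hjd
      · have : j = k := by omega
        simpa [this] using h0

theorem Acoc_add (m n : ℕ) (x : Fin 3 → ℝ) :
    Acoc (n + m) x = Acoc m (fR^[n] x) * Acoc n x := by
  induction m with
  | zero => simp [Acoc]
  | succ m ih =>
    rw [← add_assoc, Acoc_succ', ih, Acoc_succ', Matrix.mul_assoc, ← Function.iterate_add_apply,
      add_comm m n]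

/-- The row sums of the cocycle lie between `1` and `3 ^ n`. -/
theorem Acoc_mulVec_one_bounds (n : ℕ) (x : Fin 3 → ℝ) (i : Fin 3) :
    1 ≤ (Acoc n x *ᵥ 1) i ∧ (Acoc n x *ᵥ 1) i ≤ 3 ^ n := by
  induction n generalizing i with
  | zero => simp [Acoc]
  | succ n ih =>
    rw [Acoc_succ_mulVec, transpose_Mat_mulVec]
    have h0 := ih 0
    have h1 := ih 1
    have h2 := ih 2
    rw [pow_succ]
    generalize digit (fR^[n] x) = d
    fin_cases d <;> fin_cases i <;> simp <;> constructor <;> linarith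

/-- If the digits of an orbit are not confined to a set `{3, i}`, then the orbit in the open simplex
visits one of the sets `contractionSet K (1 / (m + 2))`. -/
theorem exists_mem_contractionSet {x : Fin 3 → ℝ} (hx : ∀ n, fR^[n] x ∈ simplexOpen)
    (h : ∀ i : Fin 3, ∃ n, digit (fR^[n] x) ≠ 3 ∧ digit (fR^[n] x) ≠ i.castSucc) :
    ∃ K m : ℕ, ∃ s, fR^[s] x ∈ contractionSet K (1 / ((m : ℝ) + 2)) := by
  have hgap : ∀ g s, digit (fR^[s] x) ≠ 3 → digit (fR^[s + g] x) ≠ 3 →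
      digit (fR^[s + g] x) ≠ digit (fR^[s] x) →
      ∃ K s, digit (fR^[s] x) ≠ 3 ∧ digit (fR^[s + K] x) ≠ 3 ∧
        digit (fR^[s + K] x) ≠ digit (fR^[s] x) ∧
        ∀ l, 0 < l → l < K → digit (fR^[s + l] x) = 3 := by
    intro g
    induction g using Nat.strong_induction_on with
    | _ g ih =>
      intro s h1 h2 h3
      by_cases hall : ∀ l, 0 < l → l < g → digit (fR^[s + l] x) = 3
      · exact ⟨g, s, h1, h2, h3, hall⟩
      · push Not at hall
        obtain ⟨l, hl0, hlg, hl⟩ := hall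
        by_cases hc : digit (fR^[s + l] x) = digit (fR^[s] x)
        · have e : s + l + (g - l) = s + g := by omega
          exact ih (g - l) (by omega) (s + l) hl (by rwa [e]) (by rwa [e, hc])
        · exact ih l hlg s h1 hl hc
  have hpair : ∃ K s, digit (fR^[s] x) ≠ 3 ∧ digit (fR^[s + K] x) ≠ 3 ∧
        digit (fR^[s + K] x) ≠ digit (fR^[s] x) ∧
        ∀ l, 0 < l → l < K → digit (fR^[s + l] x) = 3 := by
    obtain ⟨a, ha, -⟩ := h 0
    obtain ⟨i, hi⟩ := (eq_three_or_castSucc (digit (fR^[a] x))).resolve_left ha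
    obtain ⟨b, hb, hbi⟩ := h i
    rw [← hi] at hbi
    rcases le_total a b with hab | hab
    · obtain ⟨g, rfl⟩ := Nat.exists_eq_add_of_le hab
      exact hgap g a ha hb hbi
    · obtain ⟨g, rfl⟩ := Nat.exists_eq_add_of_le hab
      exact hgap g b hb ha hbi.symm
  obtain ⟨K, s, h1, h2, h3, h4⟩ := hpair
  have hlow : ∀ n, ∃ δ > 0, ∀ i, δ ≤ (fR^[n] x) i := fun n =>
    ⟨min (min ((fR^[n] x) 0) ((fR^[n] x) 1)) ((fR^[n] x) 2),
      lt_min (lt_min ((hx n).1 0) ((hx n).1 1)) ((hx n).1 2), fun i => by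
        fin_cases i <;> simp⟩
  obtain ⟨δ, hδ, hδ'⟩ := hlow s
  obtain ⟨ε, hε, hε'⟩ := hlow (s + K)
  obtain ⟨m, hm⟩ := exists_nat_one_div_lt (lt_min hδ hε)
  have hm' : 1 / ((m : ℝ) + 2) ≤ min δ ε :=
    (one_div_le_one_div_of_le (by positivity) (by linarith)).trans hm.le
  have e : ∀ l, fR^[l] (fR^[s] x) = fR^[s + l] x := fun l => by
    rw [← Function.iterate_add_apply, add_comm]
  refine ⟨K, m, s, h1, ?_, ?_, fun l hl hlK => ?_, fun i => ?_, fun i => ?_⟩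
  · rwa [e]
  · rwa [e]
  · rw [e]; exact h4 l hl hlK
  · exact (hm'.trans (min_le_left _ _)).trans (hδ' i)
  · rw [e]; exact (hm'.trans (min_le_right _ _)).trans (hε' i)

/-- The open triangle parametrizing the open simplex by its last two coordinates. -/
def triangle : Set (ℝ × ℝ) := {p | 0 < p.1 ∧ 0 < p.2 ∧ p.1 + p.2 < 1}

/-- The parametrization of the plane `x₀ + x₁ + x₂ = 1` by `(x₁, x₂)`. -/
def simplexParam (p : ℝ × ℝ) : Fin 3 → ℝ := ![1 - p.1 - p.2, p.1, p.2]

/-- The density of `muR` in the coordinates `(x₁, x₂)`. -/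
def reverseDensity (p : ℝ × ℝ) : ℝ :=
  4 / (Real.pi ^ 2 * (p.1 + p.2) * (1 - p.1) * (1 - p.2))

theorem measurableSet_triangle : MeasurableSet triangle :=
  (measurableSet_lt measurable_const measurable_fst).inter
    ((measurableSet_lt measurable_const measurable_snd).inter
      (measurableSet_lt (measurable_fst.add measurable_snd) measurable_const))

theorem measurable_simplexParam : Measurable simplexParam := by
  refine measurable_pi_iff.2 fun i => ?_
  fin_cases i
  · exact (measurable_const.sub measurable_fst).sub measurable_snd
  · exact measurable_fst
  · exact measurable_snd

theorem simplexParam_injective : Function.Injective simplexParam := fun _ _ h =>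
  Prod.ext (congrFun h 1) (congrFun h 2)

theorem simplexParam_mem_simplexOpen {p : ℝ × ℝ} (hp : p ∈ triangle) :
    simplexParam p ∈ simplexOpen := by
  obtain ⟨h1, h2, h3⟩ := hp
  refine ⟨fun i => ?_, ?_⟩
  · fin_cases i <;> simp [simplexParam] <;> linarith
  · simp [simplexParam]; ring

theorem muR_apply {E : Set (Fin 3 → ℝ)} (hE : MeasurableSet E) :
    muR E = ∫⁻ p in simplexParam ⁻¹' E ∩ triangle, ENNReal.ofReal (reverseDensity p) := by
  have h : muR = Measure.map simplexParam ((volume.restrict triangle).withDensity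
    fun p => ENNReal.ofReal (reverseDensity p)) := rfl
  rw [h, Measure.map_apply measurable_simplexParam hE,
    withDensity_apply _ (measurable_simplexParam hE),
    Measure.restrict_restrict (measurable_simplexParam hE)]

theorem measurable_digit : Measurable digit := by
  have h : ∀ i, MeasurableSet {x : Fin 3 → ℝ | 1 < 2 * x i} := fun i =>
    measurableSet_lt measurable_const ((measurable_pi_apply i).const_mul 2)
  exact Measurable.ite (h 0) measurable_const <| Measurable.ite (h 1) measurable_const <|
    Measurable.ite (h 2) measurable_const measurable_const

theorem measurable_fR : Measurable fR := by
  have h : ∀ i, MeasurableSet {x : Fin 3 → ℝ | 1 < 2 * x i} := fun i =>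
    measurableSet_lt measurable_const ((measurable_pi_apply i).const_mul 2)
  refine Measurable.ite (h 0) ?_ <| Measurable.ite (h 1) ?_ <| Measurable.ite (h 2) ?_ ?_ <;>
    refine measurable_pi_iff.2 fun i => ?_ <;> fin_cases i <;> simp <;> fun_prop

theorem measurableSet_contractionSet (K : ℕ) (δ : ℝ) : MeasurableSet (contractionSet K δ) := by
  have hd : ∀ l, Measurable fun x => digit (fR^[l] x) := fun l =>
    measurable_digit.comp (measurable_fR.iterate l)
  have hge : ∀ l, MeasurableSet {x : Fin 3 → ℝ | ∀ i, δ ≤ (fR^[l] x) i} := fun l => by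
    rw [Set.ofPred_forall]
    exact MeasurableSet.iInter fun i => measurableSet_le measurable_const
      ((measurable_pi_apply i).comp (measurable_fR.iterate l))
  have hmid : MeasurableSet {x : Fin 3 → ℝ | ∀ l, 0 < l → l < K → digit (fR^[l] x) = 3} := by
    simp only [Set.ofPred_forall]
    exact MeasurableSet.iInter fun l => MeasurableSet.iInter fun _ => MeasurableSet.iInter fun _ =>
      hd l (measurableSet_singleton 3)
  exact ((hd 0) (measurableSet_singleton 3).compl).inter <|
    ((hd K) (measurableSet_singleton 3).compl).inter <|
    (measurableSet_eq_fun (hd K) (hd 0)).compl.inter <| hmid.inter <| (hge 0).inter (hge K)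

/-- An affine function on the plane. -/
def affineEval (a : Fin 3 → ℝ) (p : ℝ × ℝ) : ℝ := a 0 + a 1 * p.1 + a 2 * p.2

theorem hasFDerivAt_affineEval_div (a d : Fin 3 → ℝ) (p : ℝ × ℝ) (hp : affineEval d p ≠ 0) :
    HasFDerivAt (fun p => affineEval a p / affineEval d p)
      (((a 1 * affineEval d p - affineEval a p * d 1) / affineEval d p ^ 2) •
          ContinuousLinearMap.fst ℝ ℝ ℝ +
        ((a 2 * affineEval d p - affineEval a p * d 2) / affineEval d p ^ 2) •
          ContinuousLinearMap.snd ℝ ℝ ℝ) p := by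
  have h : ∀ a : Fin 3 → ℝ, HasFDerivAt (affineEval a)
      (a 1 • ContinuousLinearMap.fst ℝ ℝ ℝ + a 2 • ContinuousLinearMap.snd ℝ ℝ ℝ) p := fun a =>
    (((hasFDerivAt_fst (𝕜 := ℝ) (p := p)).const_mul (a 1)).const_add (a 0)).add
      ((hasFDerivAt_snd (𝕜 := ℝ) (p := p)).const_mul (a 2))
  have hinv := (hasDerivAt_inv hp).comp_hasFDerivAt p (h d)
  convert! (h a).mul hinv using 1
  ext <;> simp <;> field_simp <;> ring

/-- The derivative of a fractional linear map of the plane. -/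
def fracLinDeriv (a b d : Fin 3 → ℝ) (p : ℝ × ℝ) : ℝ × ℝ →L[ℝ] ℝ × ℝ :=
  (Matrix.toLin (.finTwoProd ℝ) (.finTwoProd ℝ)
    !![(a 1 * affineEval d p - affineEval a p * d 1) / affineEval d p ^ 2,
      (a 2 * affineEval d p - affineEval a p * d 2) / affineEval d p ^ 2;
      (b 1 * affineEval d p - affineEval b p * d 1) / affineEval d p ^ 2,
      (b 2 * affineEval d p - affineEval b p * d 2) / affineEval d p ^ 2]).toContinuousLinearMap

theorem hasFDerivAt_fracLin (a b d : Fin 3 → ℝ) (p : ℝ × ℝ) (hp : affineEval d p ≠ 0) :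
    HasFDerivAt (fun p => (affineEval a p / affineEval d p, affineEval b p / affineEval d p))
      (fracLinDeriv a b d p) p := by
  unfold fracLinDeriv
  rw [Matrix.toLin_finTwoProd_toContinuousLinearMap]
  exact (hasFDerivAt_affineEval_div a d p hp).prodMk (hasFDerivAt_affineEval_div b d p hp)

theorem det_fracLinDeriv (a b d : Fin 3 → ℝ) (p : ℝ × ℝ) (hp : affineEval d p ≠ 0) :
    (fracLinDeriv a b d p).det = (!![d 0, d 1, d 2; a 0, a 1, a 2; b 0, b 1, b 2]).det /
      affineEval d p ^ 3 := by
  unfold fracLinDeriv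
  simp only [LinearMap.det_toContinuousLinearMap, LinearMap.det_toLin, Matrix.det_fin_two_of,
    Matrix.det_fin_three]
  field_simp
  simp [affineEval]
  ring

/-- The contribution to the measure of a preimage of an inverse branch of the algorithm which is
fractional linear in the coordinates `(x₁, x₂)`. -/
theorem setLIntegral_le_muR_of_branch (a b d : Fin 3 → ℝ) (i : Fin 4) (k : ℝ × ℝ → ℝ)
    (hd : ∀ q ∈ triangle, 0 < affineEval d q)
    (hT : ∀ q ∈ triangle,
      (affineEval a q / affineEval d q, affineEval b q / affineEval d q) ∈ triangle)
    (hi : ∀ q ∈ triangle, digit (simplexParam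
      (affineEval a q / affineEval d q, affineEval b q / affineEval d q)) = i)
    (hf : ∀ q ∈ triangle, fR (simplexParam
      (affineEval a q / affineEval d q, affineEval b q / affineEval d q)) = simplexParam q)
    (hk : ∀ q ∈ triangle, k q =
      |(!![d 0, d 1, d 2; a 0, a 1, a 2; b 0, b 1, b 2]).det / affineEval d q ^ 3| *
      reverseDensity (affineEval a q / affineEval d q, affineEval b q / affineEval d q))
    {E : Set (Fin 3 → ℝ)} (hE : MeasurableSet E) :
    ∫⁻ q in simplexParam ⁻¹' E ∩ triangle, ENNReal.ofReal (k q) ≤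
      muR (fR ⁻¹' E ∩ digit ⁻¹' {i}) := by
  set φ : ℝ × ℝ → ℝ × ℝ := fun q =>
    (affineEval a q / affineEval d q, affineEval b q / affineEval d q) with hφ
  set A := simplexParam ⁻¹' E ∩ triangle with hA
  have hAm : MeasurableSet A := (measurable_simplexParam hE).inter measurableSet_triangle
  have hinj : Set.InjOn φ A := fun q hq q' hq' h => simplexParam_injective <| by
    rw [← hf q hq.2, ← hf q' hq'.2]
    exact congrArg (fun p => fR (simplexParam p)) h
  have himg := lintegral_image_eq_lintegral_abs_det_fderiv_mul volume hAm
    (fun q hq => (hasFDerivAt_fracLin a b d q (hd q hq.2).ne').hasFDerivWithinAt) hinj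
    (fun p => ENNReal.ofReal (reverseDensity p))
  have hkeq : ∫⁻ q in A, ENNReal.ofReal (k q) = ∫⁻ q in A,
      ENNReal.ofReal |(fracLinDeriv a b d q).det| * ENNReal.ofReal (reverseDensity (φ q)) := by
    refine setLIntegral_congr_fun hAm fun q hq => ?_
    rw [hk q hq.2, det_fracLinDeriv a b d q (hd q hq.2).ne', ENNReal.ofReal_mul (abs_nonneg _)]
  rw [hkeq, ← himg, muR_apply ((measurable_fR hE).inter (measurable_digit
    (measurableSet_singleton i)))]
  refine lintegral_mono_set ?_
  rintro _ ⟨q, hq, rfl⟩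
  refine ⟨⟨?_, hi q hq.2⟩, hT q hq.2⟩
  show fR (simplexParam (φ q)) ∈ E
  rw [hf q hq.2]
  exact hq.1

/-- The density transported by the inverse branches of the algorithm. -/
def branchDensity (i : Fin 4) (q : ℝ × ℝ) : ℝ :=
  ![4 / (Real.pi ^ 2 * (q.1 + q.2) * (1 + q.1) * (1 + q.2)),
    4 / (Real.pi ^ 2 * (2 - q.1 - q.2) * (1 - q.1) * (1 + q.2)),
    4 / (Real.pi ^ 2 * (2 - q.1 - q.2) * (1 + q.1) * (1 - q.2)),
    8 / (Real.pi ^ 2 * (2 - q.1 - q.2) * (1 + q.1) * (1 + q.2))] i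

theorem branchDensity_pos (i : Fin 4) {q : ℝ × ℝ} (hq : q ∈ triangle) : 0 < branchDensity i q := by
  obtain ⟨h1, h2, h3⟩ := hq
  have e1 : 0 < 1 - q.1 := by linarith
  have e2 : 0 < 1 - q.2 := by linarith
  have e3 : 0 < 2 - q.1 - q.2 := by linarith
  fin_cases i <;> simp [branchDensity] <;> positivity

theorem sum_branchDensity {q : ℝ × ℝ} (hq : q ∈ triangle) :
    ∑ i, branchDensity i q = reverseDensity q := by
  obtain ⟨h1, h2, h3⟩ := hq
  have e1 : 1 - q.1 ≠ 0 := by linarith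
  have e2 : 1 - q.2 ≠ 0 := by linarith
  have e3 : 2 - q.1 - q.2 ≠ 0 := by linarith
  have e4 : 1 + q.1 ≠ 0 := by linarith
  have e5 : 1 + q.2 ≠ 0 := by linarith
  have e6 : q.1 + q.2 ≠ 0 := by linarith
  have := Real.pi_ne_zero
  simp [branchDensity, reverseDensity, Fin.sum_univ_four]
  field_simp
  ring

theorem div_mem_triangle {u v D : ℝ} (hu : 0 < u) (hv : 0 < v) (h : u + v < D) :
    (u / D, v / D) ∈ triangle := by
  have hD : 0 < D := by linarith
  refine ⟨div_pos hu hD, div_pos hv hD, ?_⟩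
  rw [← add_div, div_lt_one hD]
  exact h

theorem one_lt_two_mul_div_iff {u D : ℝ} (hD : 0 < D) : 1 < 2 * (u / D) ↔ D < 2 * u := by
  rw [← mul_div_assoc, lt_div_iff₀ hD, one_mul]

theorem simplexParam_div (u v : ℝ) {D : ℝ} (hD : 0 < D) :
    simplexParam (u / D, v / D) = ![(D - u - v) / D, u / D, v / D] := by
  have : 1 - u / D - v / D = (D - u - v) / D := by field_simp
  simp [simplexParam, this]

theorem digit_simplexParam_div (u v : ℝ) {D : ℝ} (hD : 0 < D) :
    digit (simplexParam (u / D, v / D)) =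
      if D < 2 * (D - u - v) then 0 else if D < 2 * u then 1 else if D < 2 * v then 2 else 3 := by
  rw [simplexParam_div u v hD]
  simp [digit, one_lt_two_mul_div_iff hD]

theorem fR_simplexParam_div (u v : ℝ) {D : ℝ} (hD : 0 < D) :
    fR (simplexParam (u / D, v / D)) =
      if D < 2 * (D - u - v) then
        simplexParam (u / (D - u - v), v / (D - u - v))
      else if D < 2 * u then simplexParam ((2 * u - D) / u, v / u)
      else if D < 2 * v then simplexParam (u / v, (2 * v - D) / v)
      else simplexParam (1 - 2 * (u / D), 1 - 2 * (v / D)) := by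
  rw [simplexParam_div u v hD]
  simp only [fR, one_lt_two_mul_div_iff hD, Matrix.cons_val]
  split_ifs with h0 h1 h2
  · have h : D - u - v ≠ 0 := by linarith
    ext i
    fin_cases i <;> simp [simplexParam] <;> field_simp
  · have h : u ≠ 0 := by linarith
    ext i
    fin_cases i <;> simp [simplexParam] <;> field_simp <;> ring
  · have h : v ≠ 0 := by linarith
    ext i
    fin_cases i <;> simp [simplexParam] <;> field_simp <;> ring
  · ext i
    fin_cases i <;> simp [simplexParam] <;> field_simp <;> ring

theorem abs_mul_reverseDensity_div {c u v D : ℝ} (hu : 0 < u) (hv : 0 < v) (h : u + v < D) :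
    |c / D ^ 3| * reverseDensity (u / D, v / D) =
      4 * |c| / (Real.pi ^ 2 * (u + v) * (D - u) * (D - v)) := by
  have hD : 0 < D := by linarith
  have h1 : D - u ≠ 0 := by linarith
  have h2 : D - v ≠ 0 := by linarith
  have h3 : u + v ≠ 0 := by linarith
  have hπ := Real.pi_ne_zero
  rw [abs_div, abs_of_pos (pow_pos hD 3), reverseDensity]
  have e1 : 1 - u / D = (D - u) / D := by field_simp
  have e2 : 1 - v / D = (D - v) / D := by field_simp
  simp only [e1, e2, ← add_div]
  field_simp

theorem setLIntegral_branchDensity_le (i : Fin 4) {E : Set (Fin 3 → ℝ)} (hE : MeasurableSet E) :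
    ∫⁻ q in simplexParam ⁻¹' E ∩ triangle, ENNReal.ofReal (branchDensity i q) ≤
      muR (fR ⁻¹' E ∩ digit ⁻¹' {i}) := by
  fin_cases i
  · have hD : ∀ q, affineEval ![1, 1, 1] q = 1 + q.1 + q.2 := fun q => by simp [affineEval]
    have hA : ∀ q, affineEval ![0, 1, 0] q = q.1 := fun q => by simp [affineEval]
    have hB : ∀ q, affineEval ![0, 0, 1] q = q.2 := fun q => by simp [affineEval]
    refine setLIntegral_le_muR_of_branch ![0, 1, 0] ![0, 0, 1] ![1, 1, 1] 0 _ ?_ ?_ ?_ ?_ ?_ hE <;>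
      intro q hq <;> obtain ⟨h1, h2, h3⟩ := hq <;> have hDp : 0 < 1 + q.1 + q.2 := by linarith
    all_goals simp only [hD, hA, hB]
    · exact hDp
    · exact div_mem_triangle (by linarith) (by linarith) (by linarith)
    · rw [digit_simplexParam_div _ _ hDp, if_pos (by linarith)]
    · rw [fR_simplexParam_div _ _ hDp, if_pos (by linarith)]
      congr 1
      ext <;> simp <;> ring
    · rw [abs_mul_reverseDensity_div (by linarith) (by linarith) (by linarith)]
      simp [branchDensity, Matrix.det_fin_three]
      ring_nf
  · have hD : ∀ q, affineEval ![2, -1, 0] q = 2 - q.1 := fun q => by simp [affineEval]; ring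
    have hA : ∀ q, affineEval ![1, 0, 0] q = 1 := fun q => by simp [affineEval]
    have hB : ∀ q, affineEval ![0, 0, 1] q = q.2 := fun q => by simp [affineEval]
    refine setLIntegral_le_muR_of_branch ![1, 0, 0] ![0, 0, 1] ![2, -1, 0] 1 _ ?_ ?_ ?_ ?_ ?_ hE <;>
      intro q hq <;> obtain ⟨h1, h2, h3⟩ := hq <;> have hDp : 0 < 2 - q.1 := by linarith
    all_goals simp only [hD, hA, hB]
    · exact hDp
    · exact div_mem_triangle (by linarith) (by linarith) (by linarith)
    · rw [digit_simplexParam_div _ _ hDp, if_neg (by linarith), if_pos (by linarith)]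
    · rw [fR_simplexParam_div _ _ hDp, if_neg (by linarith), if_pos (by linarith)]
      congr 1
      ext <;> simp
    · rw [abs_mul_reverseDensity_div (by linarith) (by linarith) (by linarith)]
      simp [branchDensity, Matrix.det_fin_three]
      ring_nf
  · have hD : ∀ q, affineEval ![2, 0, -1] q = 2 - q.2 := fun q => by simp [affineEval]; ring
    have hA : ∀ q, affineEval ![0, 1, 0] q = q.1 := fun q => by simp [affineEval]
    have hB : ∀ q, affineEval ![1, 0, 0] q = 1 := fun q => by simp [affineEval]
    refine setLIntegral_le_muR_of_branch ![0, 1, 0] ![1, 0, 0] ![2, 0, -1] 2 _ ?_ ?_ ?_ ?_ ?_ hE <;>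
      intro q hq <;> obtain ⟨h1, h2, h3⟩ := hq <;> have hDp : 0 < 2 - q.2 := by linarith
    all_goals simp only [hD, hA, hB]
    · exact hDp
    · exact div_mem_triangle (by linarith) (by linarith) (by linarith)
    · rw [digit_simplexParam_div _ _ hDp, if_neg (by linarith), if_neg (by linarith),
        if_pos (by linarith)]
    · rw [fR_simplexParam_div _ _ hDp, if_neg (by linarith), if_neg (by linarith),
        if_pos (by linarith)]
      congr 1
      ext <;> simp
    · rw [abs_mul_reverseDensity_div (by linarith) (by linarith) (by linarith)]
      simp [branchDensity, Matrix.det_fin_three]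
      ring_nf
  · have hD : ∀ q, affineEval ![2, 0, 0] q = 2 := fun q => by simp [affineEval]
    have hA : ∀ q, affineEval ![1, -1, 0] q = 1 - q.1 := fun q => by simp [affineEval]; ring
    have hB : ∀ q, affineEval ![1, 0, -1] q = 1 - q.2 := fun q => by simp [affineEval]; ring
    refine setLIntegral_le_muR_of_branch ![1, -1, 0] ![1, 0, -1] ![2, 0, 0] 3 _
      ?_ ?_ ?_ ?_ ?_ hE <;>
      intro q hq <;> obtain ⟨h1, h2, h3⟩ := hq <;> have hDp : (0 : ℝ) < 2 := by linarith
    all_goals simp only [hD, hA, hB]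
    · exact hDp
    · exact div_mem_triangle (by linarith) (by linarith) (by linarith)
    · rw [digit_simplexParam_div _ _ hDp, if_neg (by linarith), if_neg (by linarith),
        if_neg (by linarith)]
    · rw [fR_simplexParam_div _ _ hDp, if_neg (by linarith), if_neg (by linarith),
        if_neg (by linarith)]
      congr 1
      ext <;> simp <;> ring
    · rw [abs_mul_reverseDensity_div (by linarith) (by linarith) (by linarith)]
      simp [branchDensity, Matrix.det_fin_three]
      ring_nf

theorem integrableOn_inv_sqrt : IntegrableOn (fun t : ℝ => (√t)⁻¹) (Set.Ioo 0 1) := by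
  have h := intervalIntegral.intervalIntegrable_rpow' (a := 0) (b := 1) (r := -(1 / 2))
    (by norm_num)
  rw [intervalIntegrable_iff_integrableOn_Ioo_of_le zero_le_one] at h
  refine h.congr_fun (fun t ht => ?_) measurableSet_Ioo
  change t ^ (-(1 / 2) : ℝ) = (√t)⁻¹
  rw [Real.sqrt_eq_rpow, Real.rpow_neg ht.1.le]

theorem integrableOn_inv_sqrt_one_sub :
    IntegrableOn (fun t : ℝ => (√(1 - t))⁻¹) (Set.Ioo 0 1) := by
  have h := integrableOn_inv_sqrt
  rw [← intervalIntegrable_iff_integrableOn_Ioo_of_le zero_le_one] at h ⊢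
  have h' := h.comp_sub_left 1
  simp only [sub_zero, sub_self] at h'
  exact h'.symm

theorem inv_le_inv_sqrt_mul_inv_sqrt {s t r : ℝ} (hs : 0 < s) (ht : 0 < t) (hsr : s ≤ r)
    (htr : t ≤ r) : r⁻¹ ≤ (√s)⁻¹ * (√t)⁻¹ := by
  rw [← mul_inv]
  refine inv_anti₀ (mul_pos (Real.sqrt_pos.2 hs) (Real.sqrt_pos.2 ht)) ?_
  calc √s * √t ≤ √r * √r := mul_le_mul (Real.sqrt_le_sqrt hsr) (Real.sqrt_le_sqrt htr)
        (Real.sqrt_nonneg _) (Real.sqrt_nonneg _)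
    _ = r := Real.mul_self_sqrt (hs.le.trans hsr)

theorem reverseDensity_le {p : ℝ × ℝ} (hp : p ∈ triangle) :
    reverseDensity p ≤ 4 / Real.pi ^ 2 * ((√p.1)⁻¹ * (√p.2)⁻¹ + (√(1 - p.1))⁻¹ * (√p.2)⁻¹
      + (√p.1)⁻¹ * (√(1 - p.2))⁻¹) := by
  obtain ⟨h1, h2, h3⟩ := hp
  have hπ := Real.pi_pos
  have e1 : 0 < 1 - p.1 := by linarith
  have e2 : 0 < 1 - p.2 := by linarith
  have b0 := inv_le_inv_sqrt_mul_inv_sqrt (r := p.1 + p.2) h1 h2 (by linarith) (by linarith)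
  have b1 := inv_le_inv_sqrt_mul_inv_sqrt (r := 1 - p.1) e1 h2 le_rfl (by linarith)
  have b2 := inv_le_inv_sqrt_mul_inv_sqrt (r := 1 - p.2) h1 e2 (by linarith) le_rfl
  have key : ((p.1 + p.2) * (1 - p.1) * (1 - p.2))⁻¹
      ≤ (p.1 + p.2)⁻¹ + (1 - p.1)⁻¹ + (1 - p.2)⁻¹ := by
    have e : (p.1 + p.2)⁻¹ + (1 - p.1)⁻¹ + (1 - p.2)⁻¹
        = ((1 - p.1) * (1 - p.2) + (p.1 + p.2) * (1 - p.2) + (p.1 + p.2) * (1 - p.1))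
          * ((p.1 + p.2) * (1 - p.1) * (1 - p.2))⁻¹ := by
      field_simp
    rw [e]
    refine le_mul_of_one_le_left (by positivity) ?_
    nlinarith [mul_pos h1 h2, mul_pos h1 (by linarith : 0 < 1 - p.1 - p.2),
      mul_pos h2 (by linarith : 0 < 1 - p.1 - p.2)]
  calc reverseDensity p = 4 / Real.pi ^ 2 * ((p.1 + p.2) * (1 - p.1) * (1 - p.2))⁻¹ := by
        rw [reverseDensity]; field_simp
    _ ≤ _ := mul_le_mul_of_nonneg_left (by linarith) (by positivity)

instance isFiniteMeasure_muR : IsFiniteMeasure muR := by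
  refine ⟨?_⟩
  rw [muR_apply MeasurableSet.univ, Set.preimage_univ, Set.univ_inter]
  have hprod : ∀ f g : ℝ → ℝ, IntegrableOn f (Set.Ioo 0 1) → IntegrableOn g (Set.Ioo 0 1) →
      IntegrableOn (fun p : ℝ × ℝ => f p.1 * g p.2) triangle := by
    intro f g hf hg
    have h := Integrable.mul_prod hf hg
    rw [Measure.prod_restrict] at h
    refine IntegrableOn.mono_set (s := triangle) h fun p hp => ?_
    obtain ⟨h1, h2, h3⟩ := hp
    exact ⟨⟨h1, by linarith⟩, ⟨h2, by linarith⟩⟩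
  have hint := (((hprod _ _ integrableOn_inv_sqrt integrableOn_inv_sqrt).add
    (hprod _ _ integrableOn_inv_sqrt_one_sub integrableOn_inv_sqrt)).add
    (hprod _ _ integrableOn_inv_sqrt integrableOn_inv_sqrt_one_sub)).const_mul (4 / Real.pi ^ 2)
  refine (setLIntegral_mono_ae' measurableSet_triangle
    (Filter.Eventually.of_forall fun p hp => ?_)).trans_lt hint.lintegral_lt_top
  exact ENNReal.ofReal_le_ofReal (reverseDensity_le hp)

theorem measurable_branchDensity (i : Fin 4) : Measurable (branchDensity i) := by
  unfold branchDensity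
  fin_cases i <;> simp <;> fun_prop

theorem muR_le_muR_preimage {E : Set (Fin 3 → ℝ)} (hE : MeasurableSet E) :
    muR E ≤ muR (fR ⁻¹' E) := by
  have h1 : muR E = ∑ i, ∫⁻ q in simplexParam ⁻¹' E ∩ triangle,
      ENNReal.ofReal (branchDensity i q) := by
    rw [muR_apply hE,
      ← lintegral_finsetSum _ fun i _ => (measurable_branchDensity i).ennreal_ofReal]
    refine setLIntegral_congr_fun ((measurable_simplexParam hE).inter measurableSet_triangle)
      fun q hq => ?_
    rw [← sum_branchDensity hq.2,
      ENNReal.ofReal_sum_of_nonneg fun i _ => (branchDensity_pos i hq.2).le]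
  have hm : ∀ i, MeasurableSet (digit ⁻¹' {i}) := fun i =>
    measurable_digit (measurableSet_singleton i)
  calc muR E ≤ ∑ i, muR (fR ⁻¹' E ∩ digit ⁻¹' {i}) :=
        h1.trans_le (Finset.sum_le_sum fun i _ => setLIntegral_branchDensity_le i hE)
    _ = ∑ i, (muR.restrict (fR ⁻¹' E)) (digit ⁻¹' {i}) := by
        simp only [Measure.restrict_apply (hm _), Set.inter_comm]
    _ = muR (fR ⁻¹' E) := by
        rw [sum_measure_preimage_singleton _ fun i _ => hm i]
        simp

theorem measurePreserving_fR : MeasurePreserving fR muR muR := by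
  refine ⟨measurable_fR, Measure.ext fun E hE => ?_⟩
  rw [Measure.map_apply measurable_fR hE]
  refine le_antisymm ?_ (muR_le_muR_preimage hE)
  by_contra! hlt
  have h := ENNReal.add_lt_add_of_lt_of_le (measure_ne_top _ _) hlt (muR_le_muR_preimage hE.compl)
  rw [measure_add_measure_compl hE, Set.preimage_compl,
    measure_add_measure_compl (measurable_fR hE)] at h
  exact lt_irrefl _ h

theorem ae_orbit_mem_simplexOpen : ∀ᵐ x ∂muR, ∀ n, fR^[n] x ∈ simplexOpen := by
  have hm : MeasurableSet simplexOpen := by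
    have hpos : MeasurableSet {x : Fin 3 → ℝ | ∀ i, 0 < x i} := by
      rw [Set.ofPred_forall]
      exact MeasurableSet.iInter fun i => measurableSet_lt measurable_const (measurable_pi_apply i)
    exact hpos.inter (measurableSet_eq_fun (by fun_prop) measurable_const)
  have h0 : muR simplexOpenᶜ = 0 := by
    rw [muR_apply hm.compl]
    have : simplexParam ⁻¹' simplexOpenᶜ ∩ triangle = ∅ :=
      Set.eq_empty_of_forall_notMem fun p hp => hp.1 (simplexParam_mem_simplexOpen hp.2)
    rw [this]
    simp
  exact ae_all_iff.2 fun n => (measurePreserving_fR.iterate n).quasiMeasurePreserving.ae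
    (mem_ae_iff.2 h0)

/-- Almost every orbit has digits outside `{3, i}`. -/
theorem ae_exists_digit_ne (i : Fin 3) :
    ∀ᵐ x ∂muR, ∃ n, digit (fR^[n] x) ≠ 3 ∧ digit (fR^[n] x) ≠ i.castSucc := by
  set E : Set (Fin 3 → ℝ) := {x | ∀ n, digit (fR^[n] x) = 3 ∨ digit (fR^[n] x) = i.castSucc}
  have hE : MeasurableSet E := by
    have : E = ⋂ n, (fun x => digit (fR^[n] x)) ⁻¹' {3, i.castSucc} := by
      ext x; simp [E]
    rw [this]
    exact MeasurableSet.iInter fun n =>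
      (measurable_digit.comp (measurable_fR.iterate n)) (Set.toFinite _).measurableSet
  obtain ⟨j, hj⟩ := exists_ne i
  have hsub : E ⊆ fR ⁻¹' E := fun x hx n => by
    have := hx (n + 1)
    rwa [Function.iterate_succ_apply] at this
  have hjm : MeasurableSet (fR ⁻¹' E ∩ digit ⁻¹' {j.castSucc}) :=
    (measurable_fR hE).inter (measurable_digit (measurableSet_singleton _))
  have hdisj : Disjoint E (fR ⁻¹' E ∩ digit ⁻¹' {j.castSucc}) := by
    refine Set.disjoint_left.2 fun x hx hx' => ?_
    have h1 : digit x = j.castSucc := hx'.2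
    rcases hx 0 with h | h <;> rw [Function.iterate_zero_apply, h1] at h
    · exact absurd h (Fin.castSucc_lt_last j).ne
    · exact hj (Fin.castSucc_injective _ h)
  have hzero : muR (fR ⁻¹' E ∩ digit ⁻¹' {j.castSucc}) = 0 := by
    have h1 : muR E + muR (fR ⁻¹' E ∩ digit ⁻¹' {j.castSucc}) ≤ muR E + 0 := by
      rw [← measure_union hdisj hjm, add_zero]
      refine (measure_mono (Set.union_subset hsub Set.inter_subset_left)).trans_eq ?_
      exact measurePreserving_fR.measure_preimage hE.nullMeasurableSet
    simpa using (ENNReal.add_le_add_iff_left (measure_ne_top _ _)).1 h1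
  have hA : volume (simplexParam ⁻¹' E ∩ triangle) = 0 := by
    by_contra hne
    have hpos : 0 < ∫⁻ q in simplexParam ⁻¹' E ∩ triangle,
        ENNReal.ofReal (branchDensity j.castSucc q) := by
      rw [setLIntegral_pos_iff (measurable_branchDensity _).ennreal_ofReal]
      refine (pos_iff_ne_zero.2 hne).trans_le (measure_mono fun q hq => ⟨?_, hq⟩)
      exact (ENNReal.ofReal_pos.2 (branchDensity_pos _ hq.2)).ne'
    exact absurd (hpos.trans_le (setLIntegral_branchDensity_le _ hE)) (by simp [hzero])
  have hnull : muR E = 0 := by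
    rw [muR_apply hE, setLIntegral_measure_zero _ _ hA]
  filter_upwards [measure_eq_zero_iff_ae_notMem.1 hnull] with x hx
  simpa [E] using hx

/-- If a nonnegative antitone sequence is multiplied by at most `c ^ b n` between the times `n` and
`n + K`, then it decays like `c` to the power of the accumulated sum of `b`, divided by `K`. -/
theorem pow_le_rpow_sum_of_le_rpow_mul {u b : ℕ → ℝ} {c : ℝ} {K : ℕ} (hc : 0 < c) (hK : K ≠ 0)
    (hu : ∀ n, 0 ≤ u n) (hanti : Antitone u) (h : ∀ n, u (n + K) ≤ c ^ b n * u n) (n : ℕ) :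
    u (n + K) ^ K ≤ u 0 ^ K * c ^ ∑ l ∈ Finset.range n, b l := by
  have hprod : ∀ n, ∏ l ∈ Finset.range K, u (n + l) ≤
      u 0 ^ K * c ^ ∑ l ∈ Finset.range n, b l := by
    intro n
    induction n with
    | zero =>
      simp only [zero_add, Finset.range_zero, Finset.sum_empty, Real.rpow_zero, mul_one]
      refine (Finset.prod_le_prod (fun l _ => hu l) fun l _ => hanti (Nat.zero_le l)).trans_eq ?_
      simp
    | succ n ih =>
      rcases (hu n).eq_or_lt with h0 | h0
      · have : ∏ l ∈ Finset.range K, u (n + 1 + l) = 0 :=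
          Finset.prod_eq_zero (Finset.mem_range.2 (Nat.pos_of_ne_zero hK))
            (le_antisymm (h0 ▸ hanti (by omega)) (hu _))
        rw [this]
        exact mul_nonneg (pow_nonneg (hu 0) K) (Real.rpow_nonneg hc.le _)
      · refine le_of_mul_le_mul_right ?_ h0
        have e : (∏ l ∈ Finset.range K, u (n + 1 + l)) * u n
            = (∏ l ∈ Finset.range K, u (n + l)) * u (n + K) := by
          rw [← Finset.prod_range_succ, Finset.prod_range_succ']
          simp only [add_zero, add_assoc, add_comm 1]
        rw [e, Finset.sum_range_succ, Real.rpow_add hc]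
        calc (∏ l ∈ Finset.range K, u (n + l)) * u (n + K)
            ≤ (u 0 ^ K * c ^ ∑ l ∈ Finset.range n, b l) * (c ^ b n * u n) :=
              mul_le_mul ih (h n) (hu _)
                (mul_nonneg (pow_nonneg (hu 0) K) (Real.rpow_nonneg hc.le _))
          _ = _ := by ring
  refine le_trans ?_ (hprod n)
  calc u (n + K) ^ K = ∏ l ∈ Finset.range K, u (n + K) := by simp
    _ ≤ _ := Finset.prod_le_prod (fun _ _ => hu _) fun l hl =>
        hanti (by have := Finset.mem_range.1 hl; omega)

/-- The oscillation of the cocycle decays exponentially if the contraction set is visited with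
positive lower frequency. -/
theorem osc_Acoc_le {x w : Fin 3 → ℝ} {K k N : ℕ} {δ : ℝ} (hx : ∀ n, fR^[n] x ∈ simplexOpen)
    (h : x 0 * w 0 + x 1 * w 1 + x 2 * w 2 = 0) (hw : osc w ≤ 1) (hδ0 : 0 < δ) (hδ : δ < 1)
    (hN : ∀ n ≥ N, (n : ℝ) ≤
      birkhoffSum fR ((contractionSet K δ).indicator fun _ => (1 : ℝ)) n x * (k + 1))
    {n : ℕ} (hn : N ≤ n) :
    osc (Acoc (n + (K + 1)) x *ᵥ w) ≤
      ((1 - δ) ^ (((k : ℝ) + 1) * (K + 1))⁻¹) ^ n := by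
  have hc : 0 < 1 - δ := by linarith
  have horb : ∀ n m, fR^[m] (fR^[n] x) ∈ simplexOpen := fun n m => by
    rw [← Function.iterate_add_apply]
    exact hx _
  have key := pow_le_rpow_sum_of_le_rpow_mul (u := fun n => osc (Acoc n x *ᵥ w))
    (b := fun n => (contractionSet K δ).indicator (fun _ => (1 : ℝ)) (fR^[n] x)) (K := K + 1) hc
    (Nat.succ_ne_zero K) (fun n => osc_nonneg _) ?_ ?_ n
  · change osc (Acoc (n + (K + 1)) x *ᵥ w) ^ (K + 1) ≤ osc (Acoc 0 x *ᵥ w) ^ (K + 1) *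
      (1 - δ) ^ birkhoffSum fR ((contractionSet K δ).indicator fun _ => (1 : ℝ)) n x at key
    refine le_of_pow_le_pow_left₀ (Nat.succ_ne_zero K) (by positivity) ?_
    refine key.trans ?_
    have e0 : osc (Acoc 0 x *ᵥ w) ^ (K + 1) ≤ 1 :=
      pow_le_one₀ (osc_nonneg _) (by simpa [Acoc] using hw)
    refine (mul_le_of_le_one_left (Real.rpow_nonneg hc.le _) e0).trans ?_
    rw [← Real.rpow_natCast, ← Real.rpow_natCast, ← Real.rpow_mul hc.le, ← Real.rpow_mul hc.le]
    refine Real.rpow_le_rpow_of_exponent_ge hc (by linarith) ?_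
    have := hN n hn
    push_cast
    have e : (((k : ℝ) + 1) * (K + 1))⁻¹ * n * (K + 1) = n / (k + 1) := by
      field_simp
    rw [e, div_le_iff₀ (by positivity)]
    exact this
  · refine antitone_nat_of_succ_le fun n => ?_
    simp only [Acoc_succ_mulVec]
    exact osc_transpose_Mat_le_osc (hx n) (orthogonal_Acoc h n) _
  · intro n
    simp only [Acoc_add (K + 1) n x, ← mulVec_mulVec]
    by_cases hB : fR^[n] x ∈ contractionSet K δ
    · rw [Set.indicator_of_mem hB, Real.rpow_one]
      exact osc_le_of_mem_contractionSet (horb n) (orthogonal_Acoc h n) hδ hB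
    · rw [Set.indicator_of_notMem hB, Real.rpow_zero, one_mul]
      have := orthogonal_Acoc h n
      generalize Acoc n x *ᵥ w = v at this
      have hle : ∀ m, osc (Acoc m (fR^[n] x) *ᵥ v) ≤ osc v := by
        intro m
        induction m with
        | zero => simp [Acoc]
        | succ m ih =>
          rw [Acoc_succ_mulVec]
          exact (osc_transpose_Mat_le_osc (horb n m) (orthogonal_Acoc this m) _).trans ih
      exact hle _

/-- The approximation errors of column `c` form the image of `e_c - x_c • 1` under the cocycle. -/
theorem Acoc_sub_eq_mulVec (n : ℕ) (x : Fin 3 → ℝ) (i c : Fin 3) :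
    Acoc n x i c - (∑ j, Acoc n x i j) * x c =
      (Acoc n x *ᵥ fun j => (if j = c then 1 else 0) - x c) i := by
  simp [mulVec, dotProduct, mul_sub, Finset.sum_sub_distrib, Finset.sum_mul]

/-- The Reverse algorithm is almost everywhere exponentially convergent:
for μ-a.e. x there are α > 1 and N such that for all n ≥ N and each row i of
`A^{(n)}(x)` with row sum `pᵢ`, `max(|p_{i1} − pᵢx₁|, |p_{i2} − pᵢx₂|) < pᵢ^{1−α}`. -/
theorem reverse_exponentially_convergent :
    ∀ᵐ x ∂muR, ∃ α : ℝ, 1 < α ∧ ∃ N : ℕ, ∀ n ≥ N, ∀ i : Fin 3,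
      max |Acoc n x i 1 - (∑ j, Acoc n x i j) * x 1|
          |Acoc n x i 2 - (∑ j, Acoc n x i j) * x 2|
        < (∑ j, Acoc n x i j) ^ (1 - α) := by
  have hvisit : ∀ᵐ x ∂muR, ∀ K m : ℕ,
      (∃ s, fR^[s] x ∈ contractionSet K (1 / ((m : ℝ) + 2))) →
      ∃ k : ℕ, ∀ᶠ n : ℕ in Filter.atTop, (n : ℝ) ≤ birkhoffSum fR
        ((contractionSet K (1 / ((m : ℝ) + 2))).indicator fun _ => (1 : ℝ)) n x * (k + 1) :=
    ae_all_iff.2 fun K => ae_all_iff.2 fun m =>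
      ae_positive_frequency_of_visit measurePreserving_fR (measurableSet_contractionSet K _)
  filter_upwards [hvisit, ae_orbit_mem_simplexOpen, ae_all_iff.2 ae_exists_digit_ne]
    with x hfreq hx hdig
  obtain ⟨K, m, hs⟩ := exists_mem_contractionSet hx hdig
  obtain ⟨k, hk⟩ := hfreq K m hs
  obtain ⟨N, hN⟩ := Filter.eventually_atTop.1 hk
  have hδ0 : (0 : ℝ) < 1 / ((m : ℝ) + 2) := by positivity
  have hδ1 : 1 / ((m : ℝ) + 2) < 1 := by
    rw [div_lt_one (by positivity)]
    have : (0 : ℝ) ≤ m := by positivity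
    linarith
  generalize 1 / ((m : ℝ) + 2) = δ at hN hδ0 hδ1
  set ρ : ℝ := (1 - δ) ^ (((k : ℝ) + 1) * (K + 1))⁻¹ with hρ
  have hρ0 : 0 < ρ := Real.rpow_pos_of_pos (by linarith) _
  have hρ1 : ρ < 1 := Real.rpow_lt_one (by linarith) (by linarith) (by positivity)
  have herr : ∀ n ≥ N, ∀ i c, |Acoc (n + (K + 1)) x i c -
      (∑ j, Acoc (n + (K + 1)) x i j) * x c| ≤ ρ ^ n := by
    intro n hn i c
    have horth : x 0 * ((if (0 : Fin 3) = c then 1 else 0) - x c)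
        + x 1 * ((if (1 : Fin 3) = c then 1 else 0) - x c)
        + x 2 * ((if (2 : Fin 3) = c then 1 else 0) - x c) = 0 := by
      have := (hx 0).2
      simp only [Function.iterate_zero_apply] at this
      fin_cases c <;> simp
      · linear_combination (-x 0) * this
      · linear_combination (-x 1) * this
      · linear_combination (-x 2) * this
    have hosc : osc (fun j => (if j = c then 1 else 0) - x c) ≤ 1 := by
      refine osc_le_iff.2 fun a b => ?_
      simp only [sub_sub_sub_cancel_right]
      split_ifs <;> norm_num
    rw [Acoc_sub_eq_mulVec]
    have hle := abs_le_of_orthogonal (fun i => ((hx (n + (K + 1))).1 i).le) (hx (n + (K + 1))).2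
      (orthogonal_Acoc (w := fun j => (if j = c then 1 else 0) - x c) horth (n + (K + 1))) i
      ((hx (n + (K + 1))).1 i).le
    rw [sub_zero, one_mul] at hle
    exact hle.trans (osc_Acoc_le hx horth hosc hδ0 hδ1 hN hn)
  set β : ℝ := -Real.log ρ / (2 * Real.log 3) with hβ
  have hlog3 : 0 < Real.log 3 := Real.log_pos (by norm_num)
  have hβ0 : 0 < β := div_pos (neg_pos.2 (Real.log_neg hρ0 hρ1)) (by positivity)
  have h3β : (3 : ℝ) ^ (-β) = ρ ^ (1 / 2 : ℝ) := by
    rw [Real.rpow_def_of_pos (by norm_num), Real.rpow_def_of_pos hρ0]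
    congr 1
    rw [hβ]
    field_simp
  refine ⟨1 + β, by linarith, N + 2 * (K + 1) + 1, fun n hn i => ?_⟩
  obtain ⟨l, rfl⟩ : ∃ l, n = l + (K + 1) := ⟨n - (K + 1), by omega⟩
  have hp := Acoc_mulVec_one_bounds (l + (K + 1)) x i
  have hpsum : (Acoc (l + (K + 1)) x *ᵥ 1) i = ∑ j, Acoc (l + (K + 1)) x i j := by
    simp [mulVec, dotProduct]
  rw [hpsum] at hp
  have hlt : ρ ^ l < (∑ j, Acoc (l + (K + 1)) x i j) ^ (1 - (1 + β)) := by
    have e : 1 - (1 + β) = -β := by ring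
    rw [e]
    refine lt_of_lt_of_le ?_
      (Real.rpow_le_rpow_of_nonpos (by linarith [hp.1]) hp.2 (by linarith))
    rw [← Real.rpow_natCast_mul (by norm_num), mul_comm, Real.rpow_mul (by norm_num), h3β,
      ← Real.rpow_mul hρ0.le, ← Real.rpow_natCast]
    refine Real.rpow_lt_rpow_of_exponent_gt hρ0 hρ1 ?_
    have : N + (K + 1) + 1 ≤ l := by omega
    have h1 : ((N + (K + 1) + 1 : ℕ) : ℝ) ≤ l := by exact_mod_cast this
    push_cast at h1 ⊢
    have : (0 : ℝ) ≤ N := by positivity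
    linarith
  exact max_lt ((herr l (by omega) i 1).trans_lt hlt) ((herr l (by omega) i 2).trans_lt hlt)

end
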